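/- arXiv:2405.06755 — 3 statements merged into one kernel-verified Lean document; each statement's English description precedes it below -/
import Mathlib

section
/- There exists a locally finite connected graph that admits no rooted tree-decomposition into finite parts which is linked, tight and componental and additionally has upwards disjoint adhesion sets, i.e. satisfies V_e ∩ V_{e'} = ∅ for all edges e < e' of T in the tree-order. -/
open SimpleGraph

universe u v

section CommonDefs

variable {V : Type u} {N : Type v}

/-- `u` and `w` are joined by a walk in `G` all of whose vertices avoid `X`,
i.e. they lie in the same component of `G - X`. -/
def ConnAvoiding (G : SimpleGraph V) (X : Set V) (u w : V) : Prop :=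
  ∃ p : G.Walk u w, ∀ x ∈ p.support, x ∉ X

/-- `r` is a (one-way infinite) ray in `G`. -/
def IsRay (G : SimpleGraph V) (r : ℕ → V) : Prop :=
  Function.Injective r ∧ ∀ n : ℕ, G.Adj (r n) (r (n + 1))

/-- Two rays are equivalent (i.e. belong to the same end) if for every finite vertex set `X`
they have tails in the same component of `G - X`. -/
def RayEquiv (G : SimpleGraph V) (r r' : ℕ → V) : Prop :=
  ∀ X : Set V, X.Finite → ∃ M : ℕ, ∀ m ≥ M, ∀ n ≥ M, ConnAvoiding G X (r m) (r' n)

/-- `v` lies in the component `C_G(X, ε)` of `G - X` containing a tail of the ray `r`. -/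
def InEndComp (G : SimpleGraph V) (X : Set V) (r : ℕ → V) (v : V) : Prop :=
  ∃ M : ℕ, ∀ n ≥ M, ConnAvoiding G X v (r n)

/-- `v` dominates the end of the ray `r`. -/
def Dominates (G : SimpleGraph V) (r : ℕ → V) (v : V) : Prop :=
  ∀ X : Set V, X.Finite → v ∉ X → InEndComp G X r v

/-- `Dom(ε)` for the end `ε` of the ray `r`. -/
def DomSet (G : SimpleGraph V) (r : ℕ → V) : Set V := {v | Dominates G r v}

/-- There are `n` pairwise (vertex-)disjoint rays belonging to the end of `r`. -/
def HasDisjRays (G : SimpleGraph V) (r : ℕ → V) (n : ℕ) : Prop :=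
  ∃ f : Fin n → ℕ → V, (∀ i, IsRay G (f i)) ∧ (∀ i, RayEquiv G r (f i)) ∧
    Pairwise fun i j => ∀ k l : ℕ, f i k ≠ f j l

/-- The degree of the end of `r`, as an extended natural number. -/
noncomputable def EndDegree (G : SimpleGraph V) (r : ℕ → V) : ℕ∞ :=
  ⨆ (n : ℕ) (_ : HasDisjRays G r n), (n : ℕ∞)

/-- A family of pairwise disjoint `A`–`B` paths indexed by `ι`. -/
def DisjointPathsFam (G : SimpleGraph V) (A B : Set V) (ι : Type*) : Prop :=
  ∃ (a b : ι → V) (p : ∀ i : ι, G.Walk (a i) (b i)),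
    (∀ i, (p i).IsPath) ∧ (∀ i, a i ∈ A) ∧ (∀ i, b i ∈ B) ∧
    Pairwise fun i j => ∀ x ∈ (p i).support, x ∉ (p j).support

/-- There are `n` pairwise disjoint `A`–`B` paths in `G`. -/
def DisjointPaths (G : SimpleGraph V) (A B : Set V) (n : ℕ) : Prop :=
  DisjointPathsFam G A B (Fin n)

/-- `C` is (the vertex set of) a connected component of the subgraph of `G` induced on `S`. -/
def IsCompOf (G : SimpleGraph V) (S C : Set V) : Prop :=
  C.Nonempty ∧ C ⊆ S ∧ (G.induce C).Connected ∧
    ∀ u ∈ C, ∀ v ∈ S, G.Adj u v → v ∈ C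

/-- The neighbourhood `N_G(C)` of the set `C` in `G`. -/
def NbhdSet (G : SimpleGraph V) (C : Set V) : Set V :=
  {v | v ∉ C ∧ ∃ u ∈ C, G.Adj u v}

/-- A graph is locally finite if every vertex has finite degree. -/
def LocFin (G : SimpleGraph V) : Prop := ∀ v : V, {w : V | G.Adj v w}.Finite

/-- A tree-decomposition of `G` with decomposition tree `T`. -/
structure TreeDecomp (G : SimpleGraph V) (T : SimpleGraph N) : Type (max u v) where
  isTree : T.IsTree
  bag : N → Set V
  bag_cover : ∀ v : V, ∃ t : N, v ∈ bag t
  bag_edge : ∀ ⦃x y : V⦄, G.Adj x y → ∃ t : N, x ∈ bag t ∧ y ∈ bag t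
  bag_conn : ∀ (v : V) {s t : N} (p : T.Walk s t), p.IsPath →
    v ∈ bag s → v ∈ bag t → ∀ x ∈ p.support, v ∈ bag x

namespace TreeDecomp

variable {G : SimpleGraph V} {T : SimpleGraph N}

/-- The unique path in the tree `T` from `s` to `t`. -/
noncomputable def path (D : TreeDecomp G T) (s t : N) : T.Walk s t :=
  (D.isTree.existsUnique_path s t).choose

/-- The adhesion set of the edge `ab` of `T`. -/
def adh (D : TreeDecomp G T) (a b : N) : Set V := D.bag a ∩ D.bag b

/-- `ab` is an edge of `T` lying on the path from `s` to `t`. -/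
def EdgeOnPath (D : TreeDecomp G T) (s t a b : N) : Prop :=
  T.Adj a b ∧ s(a, b) ∈ (D.path s t).edges

/-- All bags are finite. -/
def FiniteParts (D : TreeDecomp G T) : Prop := ∀ t : N, (D.bag t).Finite

/-- The tree-decomposition is lean. -/
def IsLean (D : TreeDecomp G T) : Prop :=
  ∀ (s t : N) (Zs Zt : Finset V), ↑Zs ⊆ D.bag s → ↑Zt ⊆ D.bag t →
    Zs.card = Zt.card →
    DisjointPaths G ↑Zs ↑Zt Zs.card ∨
      ∃ a b : N, D.EdgeOnPath s t a b ∧ (D.adh a b).encard < (Zs.card : ℕ∞)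

/-- The tree-decomposition is strongly linked: for all nodes `s ≠ t` there are
`min {|V_e| : e ∈ E(sTt)}` pairwise disjoint `V_s`–`V_t` paths. -/
def StronglyLinked (D : TreeDecomp G T) : Prop :=
  ∀ s t : N, s ≠ t →
    ∃ c : Cardinal.{u},
      (∀ a b : N, D.EdgeOnPath s t a b → c ≤ Cardinal.mk ↥(D.adh a b)) ∧
      (∃ a b : N, D.EdgeOnPath s t a b ∧ c = Cardinal.mk ↥(D.adh a b)) ∧
      ∃ ι : Type u, Cardinal.mk ι = c ∧ DisjointPathsFam G (D.bag s) (D.bag t) ι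

/-- One side of the separation of `G` induced by the edge `ab` of `T`: the union of the
bags over all nodes in the component of `T - ab` containing `a`. -/
def sideSet (D : TreeDecomp G T) (a b : N) : Set V :=
  ⋃ x ∈ {x : N | b ∉ (D.path a x).support}, D.bag x

end TreeDecomp

/-- A rooted tree-decomposition. -/
structure RootedTreeDecomp (G : SimpleGraph V) (T : SimpleGraph N)
    extends TreeDecomp G T : Type (max u v) where
  root : N

namespace RootedTreeDecomp

variable {G : SimpleGraph V} {T : SimpleGraph N}

/-- The tree-order on `T` induced by the root: `s ≤ t` iff `s` lies on the path
from the root to `t`. -/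
def le (D : RootedTreeDecomp G T) (s t : N) : Prop :=
  s ∈ (D.toTreeDecomp.path D.root t).support

/-- `st` is an edge of `T` with `s < t` in the tree-order. -/
def IsOrientedEdge (D : RootedTreeDecomp G T) (s t : N) : Prop :=
  T.Adj s t ∧ D.le s t

/-- The vertex set of `G↑e` for the oriented edge `e = st`: the union of the bags over
all nodes of the component `T_e` of `T - e` not containing the root. -/
def above (D : RootedTreeDecomp G T) (t : N) : Set V :=
  ⋃ x ∈ {x : N | D.le t x}, D.bag x

/-- The vertex set of `G∘↑e` (the part strictly above `e`) for the oriented edge `e = st`. -/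
def strictAbove (D : RootedTreeDecomp G T) (s t : N) : Set V :=
  D.above t \ (D.bag s ∩ D.bag t)

/-- The rooted tree-decomposition is componental. -/
def Componental (D : RootedTreeDecomp G T) : Prop :=
  ∀ s t : N, D.IsOrientedEdge s t → (G.induce (D.strictAbove s t)).Connected

/-- The rooted tree-decomposition is tight. -/
def Tight (D : RootedTreeDecomp G T) : Prop :=
  ∀ s t : N, D.IsOrientedEdge s t →
    ∃ C : Set V, IsCompOf G (D.strictAbove s t) C ∧ NbhdSet G C = D.bag s ∩ D.bag t

/-- The rooted tree-decomposition is linked: for all comparable nodes `s < t` there are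
`min {|V_e| : e ∈ E(sTt)}` pairwise disjoint `V_s`–`V_t` paths. -/
def Linked (D : RootedTreeDecomp G T) : Prop :=
  ∀ s t : N, D.le s t → s ≠ t →
    ∃ c : Cardinal.{u},
      (∀ a b : N, D.toTreeDecomp.EdgeOnPath s t a b →
        c ≤ Cardinal.mk ↥(D.bag a ∩ D.bag b)) ∧
      (∃ a b : N, D.toTreeDecomp.EdgeOnPath s t a b ∧
        c = Cardinal.mk ↥(D.bag a ∩ D.bag b)) ∧
      ∃ ι : Type u, Cardinal.mk ι = c ∧ DisjointPathsFam G (D.bag s) (D.bag t) ι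

/-- A rooted ray of `T`, i.e. a ray starting at the root. -/
def IsRootedRay (D : RootedTreeDecomp G T) (ρ : ℕ → N) : Prop :=
  IsRay T ρ ∧ ρ 0 = D.root

/-- `liminf_{e ∈ E(R)} V_e`: the vertices lying in `V_e` for all but finitely many
edges `e` of the ray `R = ρ`. -/
def bagLiminf (D : RootedTreeDecomp G T) (ρ : ℕ → N) : Set V :=
  {v | ∃ M : ℕ, ∀ n ≥ M, v ∈ D.bag (ρ n) ∩ D.bag (ρ (n + 1))}

/-- `liminf_{e ∈ E(R)} |V_e|` for the ray `R = ρ`. -/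
noncomputable def adhLiminf (D : RootedTreeDecomp G T) (ρ : ℕ → N) : ℕ∞ :=
  Filter.liminf (fun n : ℕ => (D.bag (ρ n) ∩ D.bag (ρ (n + 1))).encard) Filter.atTop

/-- The end of the ray `r` of `G` gives rise to the rooted ray `ρ` of `T`: every ray
equivalent to `r` meets every bag along `ρ` only finitely often, and for every edge
`e = st` of `ρ` the component `C_G(V_s, ε)` is contained in `G∘↑e`. -/
def GivesRise (D : RootedTreeDecomp G T) (r : ℕ → V) (ρ : ℕ → N) : Prop :=
  D.IsRootedRay ρ ∧
  (∀ r' : ℕ → V, IsRay G r' → RayEquiv G r r' →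
    ∀ n : ℕ, {k : ℕ | r' k ∈ D.bag (ρ n)}.Finite) ∧
  (∀ (n : ℕ) (v : V), InEndComp G (D.bag (ρ n)) r v →
    v ∈ D.strictAbove (ρ n) (ρ (n + 1)))

end RootedTreeDecomp

/-- `{A, B}` is a separation of `G`. -/
def IsSeparation (G : SimpleGraph V) (A B : Set V) : Prop :=
  A ∪ B = Set.univ ∧ ∀ a ∈ A \ B, ∀ b ∈ B \ A, ¬ G.Adj a b

/-- The separation `{A, B}` separates the ends of `r` and `r'`: they live in components of
`G - (A ∩ B)` contained in different sides of `{A, B}`. -/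
def SepSeparatesEnds (G : SimpleGraph V) (A B : Set V) (r r' : ℕ → V) : Prop :=
  ((∀ v, InEndComp G (A ∩ B) r v → v ∈ A \ B) ∧
    (∀ v, InEndComp G (A ∩ B) r' v → v ∈ B \ A)) ∨
  ((∀ v, InEndComp G (A ∩ B) r v → v ∈ B \ A) ∧
    (∀ v, InEndComp G (A ∩ B) r' v → v ∈ A \ B))

/-- The separation `{A, B}` efficiently distinguishes the ends of `r` and `r'`. -/
def EffDistinguishes (G : SimpleGraph V) (A B : Set V) (r r' : ℕ → V) : Prop :=
  IsSeparation G A B ∧ SepSeparatesEnds G A B r r' ∧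
    ∀ A' B' : Set V, IsSeparation G A' B' → SepSeparatesEnds G A' B' r r' →
      (A ∩ B).encard ≤ (A' ∩ B').encard

/-- The tree-decomposition `D` distinguishes the ends of `r` and `r'` efficiently. -/
def TreeDecomp.EffDistinguishesEnds {G : SimpleGraph V} {T : SimpleGraph N}
    (D : TreeDecomp G T) (r r' : ℕ → V) : Prop :=
  ∃ a b : N, T.Adj a b ∧ EffDistinguishes G (D.sideSet a b) (D.sideSet b a) r r'

/-- `G` contains `H` as a minor. -/
def HasMinor {W : Type v} (G : SimpleGraph V) (H : SimpleGraph W) : Prop :=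
  ∃ B : W → Set V, (∀ h, (B h).Nonempty) ∧ (∀ h, (G.induce (B h)).Connected) ∧
    (Pairwise fun h h' => Disjoint (B h) (B h')) ∧
    ∀ ⦃h h'⦄, H.Adj h h' → ∃ u ∈ B h, ∃ w ∈ B h', G.Adj u w

/-- The half-grid: the graph on `ℕ × ℤ` in which `(i, j)` and `(i', j')` are adjacent
iff `|i - i'| + |j - j'| = 1`. -/
def halfGrid : SimpleGraph (ℕ × ℤ) :=
  SimpleGraph.fromRel fun p q =>
    ((p.1 : ℤ) - (q.1 : ℤ)).natAbs + (p.2 - q.2).natAbs = 1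

/-- The one-way infinite path on `ℕ`. -/
def natRayGraph : SimpleGraph ℕ :=
  SimpleGraph.fromRel fun m n => n = m + 1

/-- The path on `m` vertices. -/
def finPathGraph (m : ℕ) : SimpleGraph (Fin m) :=
  SimpleGraph.fromRel fun i j => (j : ℕ) = (i : ℕ) + 1

/-- The strong product of two graphs. -/
def strongProd {W : Type v} (G : SimpleGraph V) (H : SimpleGraph W) : SimpleGraph (V × W) :=
  SimpleGraph.fromRel fun x y =>
    (x.1 = y.1 ∨ G.Adj x.1 y.1) ∧ (x.2 = y.2 ∨ H.Adj x.2 y.2)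

end CommonDefs

namespace RootedTreeDecomp

variable {V : Type u} {N : Type v} {G : SimpleGraph V} {T : SimpleGraph N}

section TreeOrder

theorem start_notMem_support_dropUntil [DecidableEq N] {s t x : N} {q : T.Walk s t}
    (hq : q.IsPath) (hx : x ∈ q.support) (hne : x ≠ s) : s ∉ (q.dropUntil x hx).support := by
  intro hs
  have hnd := hq.support_nodup
  rw [← q.take_spec hx, Walk.support_append, List.nodup_append] at hnd
  rw [← Walk.cons_tail_support, List.mem_cons] at hs
  exact hnd.2.2 s (Walk.start_mem_support _) s (hs.resolve_left hne.symm) rfl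

theorem isPath_path (D : TreeDecomp G T) (s t : N) : (D.path s t).IsPath :=
  (D.isTree.existsUnique_path s t).choose_spec.1

theorem eq_path (D : TreeDecomp G T) {s t : N} {p : T.Walk s t} (hp : p.IsPath) :
    p = D.path s t :=
  (D.isTree.existsUnique_path s t).choose_spec.2 p hp

variable (D : RootedTreeDecomp G T)

theorem le_iff_forall_walk {s t : N} :
    D.le s t ↔ ∀ p : T.Walk D.root t, s ∈ p.support := by
  classical
  refine ⟨fun h p => ?_, fun h => h _⟩
  have := eq_path D.toTreeDecomp p.bypass_isPath
  unfold le at h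
  rw [← this] at h
  exact p.support_bypass_subset_support h

theorem not_le_iff_exists_walk {s t : N} :
    ¬ D.le s t ↔ ∃ p : T.Walk D.root t, s ∉ p.support := by
  rw [le_iff_forall_walk, not_forall]

theorem le_refl (t : N) : D.le t t := Walk.end_mem_support _

theorem root_le (t : N) : D.le D.root t := Walk.start_mem_support _

variable {D}

theorem le_trans {r s t : N} (h : D.le r s) (h' : D.le s t) : D.le r t := by
  classical
  rw [le_iff_forall_walk] at h h' ⊢
  intro p
  exact p.support_takeUntil_subset_support (h' p) (h (p.takeUntil s (h' p)))

theorem takeUntil_eq_path {s t : N} (h : D.le s t) [DecidableEq N] :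
    (D.toTreeDecomp.path D.root t).takeUntil s h = D.toTreeDecomp.path D.root s :=
  eq_path _ ((isPath_path _ _ _).takeUntil h)

theorem le_antisymm {s t : N} (h : D.le s t) (h' : D.le t s) : s = t := by
  classical
  by_contra hne
  refine Walk.endpoint_notMem_support_takeUntil (isPath_path D.toTreeDecomp D.root t) h
    (Ne.symm hne) ?_
  rw [takeUntil_eq_path h]
  exact h'

theorem le_total_of_le {s s' t : N} (h : D.le s t) (h' : D.le s' t) :
    D.le s s' ∨ D.le s' s := by
  classical
  by_contra! hc
  obtain ⟨⟨q, hq⟩, ⟨p, hp⟩⟩ :=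
    And.imp D.not_le_iff_exists_walk.1 D.not_le_iff_exists_walk.1 hc
  set P := D.toTreeDecomp.path D.root t
  have hP : P.IsPath := isPath_path _ _ _
  have hmem : s' ∈ (P.dropUntil s h).support := by
    have := D.le_iff_forall_walk.1 h' (p.append (P.dropUntil s h))
    rw [Walk.mem_support_append_iff] at this
    exact this.resolve_left hp
  have hR := hP.dropUntil h
  have := D.le_iff_forall_walk.1 h (q.append ((P.dropUntil s h).dropUntil s' hmem))
  rw [Walk.mem_support_append_iff] at this
  have hs := this.resolve_left hq
  have hne : s' ≠ s := fun e => hq (e ▸ q.end_mem_support)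
  exact start_notMem_support_dropUntil hR hmem hne hs

/-- The only neighbour of `t` that is not above `t` is its predecessor. -/
theorem IsOrientedEdge.eq_of_adj {s t z : N} (h : D.IsOrientedEdge s t) (hz : T.Adj z t)
    (hzt : ¬ D.le t z) : z = s := by
  have hp : ((D.toTreeDecomp.path D.root z).concat hz).IsPath :=
    (isPath_path _ _ _).concat hzt hz
  have hs := D.le_iff_forall_walk.1 h.2 ((D.toTreeDecomp.path D.root z).concat hz)
  simpa using (D.isTree.isAcyclic.eq_penultimate_of_adj_end hp h.1.symm hs).symm

theorem exists_adj_mem_support {t u y : N} (q : T.Walk u y) (hu : ¬ D.le t u)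
    (hy : D.le t y) : ∃ z ∈ q.support, t ∈ q.support ∧ T.Adj z t ∧ ¬ D.le t z := by
  induction q with
  | nil => exact absurd hy hu
  | @cons u w y hadj q ih =>
    by_cases hw : D.le t w
    · obtain ⟨r, hr⟩ := D.not_le_iff_exists_walk.1 hu
      have := D.le_iff_forall_walk.1 hw (r.concat hadj)
      rw [Walk.support_concat] at this
      have htw : t = w := by simpa [hr] using this
      subst htw
      exact ⟨u, by simp, by simp, hadj, hu⟩
    · obtain ⟨z, hz, ht, h⟩ := ih hw hy
      exact ⟨z, by simp [hz], by simp [ht], h⟩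

theorem le_of_mem_support_path {s t x : N} (h : D.le s t)
    (hx : x ∈ (D.toTreeDecomp.path s t).support) : D.le s x ∧ D.le x t := by
  classical
  constructor
  · by_contra hsx
    obtain ⟨r, hr⟩ := D.not_le_iff_exists_walk.1 hsx
    have hne : x ≠ s := fun e => hr (e ▸ r.end_mem_support)
    have := D.le_iff_forall_walk.1 h (r.append ((D.toTreeDecomp.path s t).dropUntil x hx))
    rw [Walk.mem_support_append_iff] at this
    exact start_notMem_support_dropUntil (isPath_path _ _ _) hx hne (this.resolve_left hr)
  · have hd : (D.toTreeDecomp.path D.root t).dropUntil s h = D.toTreeDecomp.path s t :=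
      eq_path _ ((isPath_path _ _ _).dropUntil h)
    rw [← hd] at hx
    exact Walk.support_dropUntil_subset_support _ h hx

theorem exists_isOrientedEdge_of_le {t u : N} (h : D.le t u) (hne : t ≠ u) :
    ∃ t', D.IsOrientedEdge t t' ∧ D.le t' u := by
  have hn : ¬ (D.toTreeDecomp.path t u).Nil := fun hn => hne hn.eq
  have := le_of_mem_support_path h (Walk.getVert_mem_support (D.toTreeDecomp.path t u) 1)
  exact ⟨_, ⟨Walk.adj_snd hn, this.1⟩, this.2⟩

theorem exists_isOrientedEdge_of_edgeOnPath {s t a b : N} (h : D.le s t)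
    (hab : D.toTreeDecomp.EdgeOnPath s t a b) :
    ∃ p f, D.IsOrientedEdge p f ∧ D.le s f ∧ D.le f t ∧
      D.bag p ∩ D.bag f = D.bag a ∩ D.bag b := by
  have ha := le_of_mem_support_path h (Walk.fst_mem_support_of_mem_edges _ hab.2)
  have hb := le_of_mem_support_path h (Walk.snd_mem_support_of_mem_edges _ hab.2)
  rcases le_total_of_le ha.2 hb.2 with hle | hle
  · exact ⟨a, b, ⟨hab.1, hle⟩, hb.1, hb.2, rfl⟩
  · exact ⟨b, a, ⟨hab.1.symm, hle⟩, ha.1, ha.2, Set.inter_comm _ _⟩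

variable (D) in
/-- The distance of a node from the root. -/
noncomputable def depth (t : N) : ℕ := (D.toTreeDecomp.path D.root t).length

theorem depth_le_of_le {s t : N} (h : D.le s t) : D.depth s ≤ D.depth t := by
  classical
  unfold depth
  rw [← takeUntil_eq_path h]
  exact Walk.length_takeUntil_le_length _ h

theorem IsOrientedEdge.not_le {s t : N} (h : D.IsOrientedEdge s t) : ¬ D.le t s :=
  fun h' => h.1.ne (le_antisymm h.2 h')

theorem IsOrientedEdge.depth_eq {s t : N} (h : D.IsOrientedEdge s t) :
    D.depth t = D.depth s + 1 := by
  unfold depth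
  rw [← eq_path D.toTreeDecomp ((isPath_path D.toTreeDecomp D.root s).concat h.not_le h.1),
    Walk.length_concat]

end TreeOrder

section Bags

variable {D : RootedTreeDecomp G T}

theorem mem_above {t : N} {x : V} : x ∈ D.above t ↔ ∃ u, D.le t u ∧ x ∈ D.bag u := by
  simp [above]

theorem bag_subset_above (t : N) : D.bag t ⊆ D.above t :=
  fun _ hx => mem_above.2 ⟨t, D.le_refl t, hx⟩

theorem above_subset_of_le {s t : N} (h : D.le s t) : D.above t ⊆ D.above s := by
  intro x hx
  obtain ⟨u, hu, hxu⟩ := mem_above.1 hx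
  exact mem_above.2 ⟨u, le_trans h hu, hxu⟩

theorem mem_bag_of_not_le {t u : N} {x : V} (hx : x ∈ D.above t) (hu : ¬ D.le t u)
    (hxu : x ∈ D.bag u) : x ∈ D.bag t := by
  obtain ⟨y, hy, hxy⟩ := mem_above.1 hx
  obtain ⟨_, _, ht, _⟩ := exists_adj_mem_support (D.toTreeDecomp.path u y) hu hy
  exact D.bag_conn x _ (isPath_path _ _ _) hxu hxy t ht

theorem IsOrientedEdge.mem_adhesion {s t u : N} {x : V} (h : D.IsOrientedEdge s t)
    (hx : x ∈ D.above t) (hu : ¬ D.le t u) (hxu : x ∈ D.bag u) : x ∈ D.bag s ∩ D.bag t := by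
  obtain ⟨y, hy, hxy⟩ := mem_above.1 hx
  obtain ⟨z, hz, ht, hadj, hzt⟩ := exists_adj_mem_support (D.toTreeDecomp.path u y) hu hy
  obtain rfl := h.eq_of_adj hadj hzt
  exact ⟨D.bag_conn x _ (isPath_path _ _ _) hxu hxy z hz,
    D.bag_conn x _ (isPath_path _ _ _) hxu hxy t ht⟩

theorem above_adj {t : N} {x y : V} (hx : x ∈ D.above t) (hxt : x ∉ D.bag t)
    (h : G.Adj x y) : y ∈ D.above t := by
  obtain ⟨u, hxu, hyu⟩ := D.bag_edge h
  by_cases hu : D.le t u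
  · exact mem_above.2 ⟨u, hu, hyu⟩
  · exact absurd (mem_bag_of_not_le hx hu hxu) hxt

theorem IsOrientedEdge.above_adj {s t : N} {x y : V} (h : D.IsOrientedEdge s t)
    (hx : x ∈ D.strictAbove s t) (hxy : G.Adj x y) : y ∈ D.above t := by
  obtain ⟨u, hxu, hyu⟩ := D.bag_edge hxy
  by_cases hu : D.le t u
  · exact mem_above.2 ⟨u, hu, hyu⟩
  · exact absurd (h.mem_adhesion hx.1 hu hxu) hx.2

/-- Nodes with a common vertex strictly above one and above the other are comparable. -/
theorem IsOrientedEdge.comparable {s t t' : N} {x : V} (h : D.IsOrientedEdge s t)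
    (hx : x ∈ D.strictAbove s t) (hx' : x ∈ D.above t') : D.le t t' ∨ D.le t' t := by
  obtain ⟨u, hu, hxu⟩ := mem_above.1 hx'
  by_cases htu : D.le t u
  · exact le_total_of_le htu hu
  · exact absurd (h.mem_adhesion hx.1 htu hxu) hx.2

theorem induce_connected_subset {A C X : Set V} (hA : (G.induce A).Connected)
    (hC : ∀ u ∈ C, ∀ v, G.Adj u v → v ∈ C ∪ X) (hX : Disjoint A X) {x : V} (hxA : x ∈ A)
    (hxC : x ∈ C) : A ⊆ C := by
  intro y hy
  obtain ⟨p⟩ := hA.preconnected ⟨x, hxA⟩ ⟨y, hy⟩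
  suffices ∀ u v : A, (G.induce A).Walk u v → (u : V) ∈ C → (v : V) ∈ C from this _ _ p hxC
  intro u v p
  induction p with
  | nil => exact id
  | @cons u w v h p ih =>
    intro hu
    exact ih ((hC u hu w h).resolve_right fun hw => Set.disjoint_left.1 hX w.2 hw)

theorem exists_mem_support_of_closed {C X : Set V}
    (hC : ∀ u ∈ C, ∀ v, G.Adj u v → v ∈ C ∪ X) {u v : V} (p : G.Walk u v) (hu : u ∉ C)
    (hv : v ∈ C) : ∃ x ∈ p.support, x ∈ X := by
  induction p with
  | nil => exact absurd hv hu
  | @cons u w v h p ih =>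
    by_cases hw : w ∈ C
    · exact ⟨u, by simp, (hC w hw u h.symm).resolve_left hu⟩
    · obtain ⟨x, hx, hxX⟩ := ih hw hv
      exact ⟨x, by simp [hx], hxX⟩

/-- In a componental and tight tree-decomposition, the part above an edge lies in a set closed
under adjacency up to `X` as soon as it avoids `X` and meets that set strictly. -/
theorem IsOrientedEdge.above_subset {s t : N} (h : D.IsOrientedEdge s t) (hT : D.Tight)
    (hK : D.Componental) {C X : Set V} (hC : ∀ u ∈ C, ∀ v, G.Adj u v → v ∈ C ∪ X)
    (hX : Disjoint (D.above t) X) {x : V} (hx : x ∈ D.strictAbove s t) (hxC : x ∈ C) :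
    D.above t ⊆ C := by
  have hA : D.strictAbove s t ⊆ C :=
    induce_connected_subset (hK s t h) hC (hX.mono_left Set.sdiff_subset) hx hxC
  intro y hy
  by_cases hys : y ∈ D.bag s ∩ D.bag t
  · obtain ⟨C', hC', hN⟩ := hT s t h
    rw [← hN] at hys
    obtain ⟨_, u, hu, huy⟩ := hys
    exact (hC u (hA (hC'.2.1 hu)) y huy).resolve_right fun hyX => Set.disjoint_left.1 hX hy hyX
  · exact hA ⟨hy, hys⟩

end Bags

end RootedTreeDecomp

/-- A thick ray: consecutive fibres of size four are completely joined. -/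
structure IsThickRay {V : Type u} (G : SimpleGraph V) (P : ℕ → Fin 4 → V) : Prop where
  inj : ∀ ⦃k i l j⦄, P k i = P l j → k = l ∧ i = j
  adj : ∀ k i j, G.Adj (P k i) (P (k + 1) j)

namespace IsThickRay

variable {V : Type u} {N : Type v} {G : SimpleGraph V} {T : SimpleGraph N}
  {D : RootedTreeDecomp G T} {P Q : ℕ → Fin 4 → V}

theorem exists_forall_notMem (hP : IsThickRay G P) {X : Set V} (hX : X.Finite) :
    ∃ K, ∀ k ≥ K, ∀ i, P k i ∉ X := by
  have hinj : Function.Injective fun a : ℕ × Fin 4 => P a.1 a.2 :=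
    fun a b h => Prod.ext (hP.inj h).1 (hP.inj h).2
  have hfin := (hX.preimage hinj.injOn).image Prod.fst
  obtain ⟨K, hK⟩ := hfin.bddAbove
  refine ⟨K + 1, fun k hk i hi => ?_⟩
  have : k ≤ K := hK ⟨(k, i), hi, rfl⟩
  omega

theorem exists_column (hP : IsThickRay G P) {X : Set V} (hX : X.Finite) (hcard : X.ncard ≤ 3) :
    ∃ i, ∀ k, P k i ∉ X := by
  by_contra! h
  choose f hf using h
  have hinj : Function.Injective fun i => P (f i) i := fun i j h => (hP.inj h).2
  have h1 := Set.ncard_le_ncard (Set.range_subset_iff.2 hf) hX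
  rw [← Set.image_univ, Set.ncard_image_of_injective _ hinj, Set.ncard_univ, Nat.card_fin] at h1
  omega

/-- All but finitely many fibres of `P` lie above `t`. -/
def Captured (D : RootedTreeDecomp G T) (P : ℕ → Fin 4 → V) (t : N) : Prop :=
  ∃ K, ∀ k ≥ K, ∀ i, P k i ∈ D.above t

theorem Captured.mono {s t : N} (h : Captured D P t) (hst : D.le s t) : Captured D P s :=
  h.imp fun _ hK k hk i => RootedTreeDecomp.above_subset_of_le hst (hK k hk i)

theorem Captured.exists_isOrientedEdge (hP : IsThickRay G P) (hfin : D.toTreeDecomp.FiniteParts)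
    {t : N} (h : Captured D P t) : ∃ t', D.IsOrientedEdge t t' ∧ Captured D P t' := by
  obtain ⟨K, hK⟩ := h
  obtain ⟨L, hL⟩ := hP.exists_forall_notMem (hfin t)
  obtain ⟨u, hu, hxu⟩ := RootedTreeDecomp.mem_above.1 (hK (max K L) (le_max_left _ _) 0)
  have hLt : ∀ k ≥ max K L, ∀ i, P k i ∉ D.bag t :=
    fun k hk => hL k ((le_max_right _ _).trans hk)
  have hne : t ≠ u := fun e => hLt _ le_rfl 0 (e ▸ hxu)
  obtain ⟨t', ht', hle⟩ := RootedTreeDecomp.exists_isOrientedEdge_of_le hu hne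
  refine ⟨t', ht', max K L + 1, fun k hk => ?_⟩
  have step : ∀ k ≥ max K L, P k 0 ∈ D.above t' → ∀ i, P (k + 1) i ∈ D.above t' :=
    fun k hk h i => ht'.above_adj ⟨h, fun h => hLt k hk 0 h.1⟩ (hP.adj k 0 i)
  induction k, hk using Nat.le_induction with
  | base => exact step _ le_rfl (RootedTreeDecomp.mem_above.2 ⟨u, hle, hxu⟩)
  | succ k hk ih => exact step k (Nat.le_of_succ_le hk) (ih 0)

theorem exists_captured_depth (hP : IsThickRay G P) (hfin : D.toTreeDecomp.FiniteParts) (d : ℕ) :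
    ∃ t, D.depth t = d ∧ Captured D P t := by
  induction d with
  | zero =>
    refine ⟨D.root, ?_, 0, fun k _ i => ?_⟩
    · unfold RootedTreeDecomp.depth
      rw [← RootedTreeDecomp.eq_path D.toTreeDecomp Walk.IsPath.nil, Walk.length_nil]
    · obtain ⟨u, hu⟩ := D.bag_cover (P k i)
      exact RootedTreeDecomp.mem_above.2 ⟨u, D.root_le u, hu⟩
  | succ d ih =>
    obtain ⟨t, rfl, ht⟩ := ih
    obtain ⟨t', ht', h⟩ := ht.exists_isOrientedEdge hP hfin
    exact ⟨t', ht'.depth_eq, h⟩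

/-- With upwards disjoint adhesion sets, a thick ray is captured above arbitrary finite sets. -/
theorem exists_captured_disjoint (hP : IsThickRay G P) (hfin : D.toTreeDecomp.FiniteParts)
    (hdisj : ∀ s t s' t' : N, D.IsOrientedEdge s t → D.IsOrientedEdge s' t' →
      D.le t t' → t ≠ t' → (D.bag s ∩ D.bag t) ∩ (D.bag s' ∩ D.bag t') = ∅)
    {X : Set V} (hX : X.Finite) :
    ∃ s t, D.IsOrientedEdge s t ∧ Captured D P t ∧ Disjoint (D.above t) X := by
  choose b hb using D.bag_cover
  obtain ⟨d, hd⟩ := (hX.image fun x => D.depth (b x)).bddAbove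
  obtain ⟨r, hr, hrc⟩ := hP.exists_captured_depth hfin (d + 1)
  obtain ⟨s, hs, hsc⟩ := hrc.exists_isOrientedEdge hP hfin
  obtain ⟨t, ht, htc⟩ := hsc.exists_isOrientedEdge hP hfin
  refine ⟨s, t, ht, htc, Set.disjoint_left.2 fun x hxt hxX => ?_⟩
  have hdx : D.depth (b x) ≤ d := hd ⟨x, hxX, rfl⟩
  have hns : ¬ D.le s (b x) := fun h => by
    have := RootedTreeDecomp.depth_le_of_le h
    have := hs.depth_eq
    omega
  have hnt : ¬ D.le t (b x) := fun h => hns (RootedTreeDecomp.le_trans ht.2 h)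
  have h1 := hs.mem_adhesion (RootedTreeDecomp.above_subset_of_le ht.2 hxt) hns (hb x)
  have h2 := ht.mem_adhesion hxt hnt (hb x)
  have := hdisj _ _ _ _ hs ht ht.2 ht.1.ne
  exact (this ▸ ⟨h1, h2⟩ : x ∈ (∅ : Set V))

theorem exists_mem_strictAbove (hP : IsThickRay G P) (hfin : D.toTreeDecomp.FiniteParts)
    {s t : N} (h : Captured D P t) : ∃ K, ∀ k ≥ K, ∀ i, P k i ∈ D.strictAbove s t := by
  obtain ⟨K, hK⟩ := h
  obtain ⟨L, hL⟩ := hP.exists_forall_notMem (hfin s)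
  exact ⟨max K L, fun k hk i =>
    ⟨hK k ((le_max_left _ _).trans hk) i, fun h => hL k ((le_max_right _ _).trans hk) i h.1⟩⟩

theorem mem_strictAbove_of_column {s t : N} (hP : IsThickRay G P) (h : D.IsOrientedEdge s t)
    {i : Fin 4} (hi : ∀ k, P k i ∉ D.bag s ∩ D.bag t) {k : ℕ} (hk : P k i ∈ D.above t) (l : ℕ) :
    P l i ∈ D.strictAbove s t := by
  have h0 : P 0 i ∈ D.above t := by
    induction k with
    | zero => exact hk
    | succ k ih => exact ih (h.above_adj ⟨hk, hi _⟩ (hP.adj k i i).symm)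
  refine ⟨?_, hi l⟩
  induction l with
  | zero => exact h0
  | succ l ih => exact h.above_adj ⟨ih, hi _⟩ (hP.adj l i i)

/-- A small adhesion set separating two thick rays contains every vertex joined to complete
fibres of both. -/
theorem mem_adhesion_of_adj (hP : IsThickRay G P) (hQ : IsThickRay G Q)
    (hfin : D.toTreeDecomp.FiniteParts) {s t : N} (h : D.IsOrientedEdge s t)
    (hcard : (D.bag s ∩ D.bag t).ncard ≤ 3) (hP0 : ∀ i, P 0 i ∉ D.above t)
    (hQc : Captured D Q t) {n m : ℕ} {w : V} (hPw : ∀ i, G.Adj (P n i) w)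
    (hQw : ∀ i, G.Adj (Q m i) w) : w ∈ D.bag s ∩ D.bag t := by
  have hfin' : (D.bag s ∩ D.bag t).Finite := (hfin s).inter_of_left _
  obtain ⟨i, hi⟩ := hP.exists_column hfin' hcard
  obtain ⟨j, hj⟩ := hQ.exists_column hfin' hcard
  obtain ⟨K, hK⟩ := hQc
  by_contra hw
  have hwt := h.above_adj (hQ.mem_strictAbove_of_column h hj (hK K le_rfl j) m) (hQw j)
  have hn := h.above_adj ⟨hwt, hw⟩ (hPw i).symm
  exact hP0 i (hP.mem_strictAbove_of_column h hi hn 0).1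

/-- In a linked decomposition, a small set `X` separating `Q` from the bag of `s` gives rise to
a small adhesion set above `s`. -/
theorem exists_adhesion_ncard_le (hQ : IsThickRay G Q) (hfin : D.toTreeDecomp.FiniteParts)
    (hL : D.Linked) (hT : D.Tight) (hK : D.Componental)
    (hdisj : ∀ s t s' t' : N, D.IsOrientedEdge s t → D.IsOrientedEdge s' t' →
      D.le t t' → t ≠ t' → (D.bag s ∩ D.bag t) ∩ (D.bag s' ∩ D.bag t') = ∅)
    {C X : Set V} (hXfin : X.Finite) (hC : ∀ u ∈ C, ∀ v, G.Adj u v → v ∈ C ∪ X)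
    (hQC : ∀ k i, Q k i ∈ C) {s : N} (hs : Disjoint (D.bag s) C)
    (hQs : ∀ k i, Q k i ∈ D.above s) {x : V} (hx : x ∈ D.above s) (hxC : x ∉ C) :
    ∃ p f, D.IsOrientedEdge p f ∧ D.le s f ∧ Captured D Q f ∧
      (D.bag p ∩ D.bag f).ncard ≤ X.ncard := by
  obtain ⟨q, t, hqt, htc, hdt⟩ := hQ.exists_captured_disjoint hfin hdisj hXfin
  obtain ⟨K, hKt⟩ := hQ.exists_mem_strictAbove (s := q) hfin htc
  have htC : D.above t ⊆ C := hqt.above_subset hT hK hC hdt (hKt K le_rfl 0) (hQC K 0)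
  have hnts : ¬ D.le t s := fun h => hxC (htC (RootedTreeDecomp.above_subset_of_le h hx))
  have hst : D.le s t := (hqt.comparable (hKt K le_rfl 0) (hQs K 0)).resolve_left hnts
  have hne : s ≠ t := fun e => hnts (e ▸ D.le_refl t)
  obtain ⟨c, -, ⟨a, b, hab, hc⟩, ι, hι, y, z, P, -, hy, hz, hPd⟩ := hL s t hst hne
  obtain ⟨p, f, hpf, hsf, hft, heq⟩ := RootedTreeDecomp.exists_isOrientedEdge_of_edgeOnPath hst hab
  refine ⟨p, f, hpf, hsf, htc.mono hft, ?_⟩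
  have hmeet : ∀ i, ∃ x ∈ (P i).support, x ∈ X := fun i =>
    RootedTreeDecomp.exists_mem_support_of_closed hC (P i)
      (Set.disjoint_left.1 hs (hy i)) (htC (RootedTreeDecomp.bag_subset_above t (hz i)))
  choose g hg hgX using hmeet
  have hginj : Function.Injective fun i => (⟨g i, hgX i⟩ : X) := by
    intro i j hij
    by_contra hne
    exact hPd hne _ (hg i) (by rw [Subtype.mk.inj hij]; exact hg j)
  have hcard := Cardinal.mk_le_of_injective hginj
  rw [hι, hc, ← heq, ← Set.cast_ncard hXfin,
    ← Set.cast_ncard ((hfin p).inter_of_left _)] at hcard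
  exact_mod_cast hcard

end IsThickRay

namespace ThickRayTree

/-- The vertices of the counterexample: a thick ray `trunk`, and for each `n` four vertices
`sep n` joining the `n`-th fibre of the trunk to two further thick rays `mid n` and `left n`. -/
inductive Vertex : Type
  | trunk (k : ℕ) (i : Fin 4)
  | sep (n : ℕ) (w : Fin 4)
  | mid (n k : ℕ) (i : Fin 4)
  | left (n k : ℕ) (i : Fin 4)

open Vertex

/-- The edges of the counterexample, each in one orientation. The three vertices `sep n 0`,
`sep n 1`, `sep n 2` separate the trunk from `mid n`, and the two vertices `sep n 0`, `sep n 3`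
separate the trunk from `left n`. -/
inductive Link : Vertex → Vertex → Prop
  | trunk (k i j) : Link (trunk k i) (trunk (k + 1) j)
  | mid (n k i j) : Link (mid n k i) (mid n (k + 1) j)
  | left (n k i j) : Link (left n k i) (left n (k + 1) j)
  | trunk_sep (n i w) (hw : w ≠ 3) : Link (trunk n i) (sep n w)
  | sep_mid (n w j) : Link (sep n w) (mid n 0 j)
  | sep_left (n w j) (hw : w = 0 ∨ w = 3) : Link (sep n w) (left n 0 j)

/-- The counterexample graph. -/
def graph : SimpleGraph Vertex where
  Adj x y := Link x y ∨ Link y x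
  symm := ⟨fun _ _ h => h.symm⟩
  loopless := ⟨fun x h => by cases x <;> rcases h with h | h <;> cases h⟩

theorem Link.adj {x y : Vertex} (h : Link x y) : graph.Adj x y := Or.inl h

/-- The index of the fibre of the trunk at which a vertex is attached. -/
def Vertex.index : Vertex → ℕ
  | trunk k _ => k
  | sep n _ => n
  | mid n _ _ => n
  | left n _ _ => n

/-- A numbering of the vertices with finite fibres that varies by at most one along edges. -/
def Vertex.rank : Vertex → ℕ
  | trunk k _ => k
  | sep n _ => n
  | mid n k _ => n + k
  | left n k _ => n + k

theorem finite_rank_le (d : ℕ) : {x : Vertex | x.rank ≤ d}.Finite := by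
  have hfin : (Set.Iic d ×ˢ (Set.univ : Set (Fin 4))).Finite :=
    (Set.finite_Iic d).prod Set.finite_univ
  have hfin' : (Set.Iic d ×ˢ Set.Iic d ×ˢ (Set.univ : Set (Fin 4))).Finite :=
    (Set.finite_Iic d).prod ((Set.finite_Iic d).prod Set.finite_univ)
  refine ((hfin.image fun a => trunk a.1 a.2).union <|
    (hfin.image fun a => sep a.1 a.2).union <|
    (hfin'.image fun a => mid a.1 a.2.1 a.2.2).union
    (hfin'.image fun a => left a.1 a.2.1 a.2.2)).subset ?_
  rintro (⟨k, i⟩ | ⟨n, w⟩ | ⟨n, k, i⟩ | ⟨n, k, i⟩) h <;>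
    simp only [Vertex.rank, Set.mem_ofPred_eq] at h <;> simp <;> omega

theorem rank_le_of_adj {x y : Vertex} (h : graph.Adj x y) : y.rank ≤ x.rank + 1 := by
  rcases h with h | h <;> cases h <;> simp only [Vertex.rank] <;> omega

theorem locFin_graph : LocFin graph := fun x =>
  (finite_rank_le (x.rank + 1)).subset fun _ h => rank_le_of_adj h

theorem connected_graph : graph.Connected := by
  have htrunk : ∀ k i, graph.Reachable (trunk 0 0) (trunk k i) := by
    intro k
    induction k with
    | zero =>
      intro i
      exact (Link.trunk 0 0 0).adj.reachable.trans (Link.trunk 0 i 0).adj.reachable.symm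
    | succ k ih => exact fun i => (ih 0).trans (Link.trunk k 0 i).adj.reachable
  have hsep0 : ∀ n, graph.Reachable (trunk 0 0) (sep n 0) := fun n =>
    (htrunk n 0).trans (Link.trunk_sep n 0 0 (by decide)).adj.reachable
  have hmid : ∀ n k i, graph.Reachable (trunk 0 0) (mid n k i) := by
    intro n k
    induction k with
    | zero => exact fun i => (hsep0 n).trans (Link.sep_mid n 0 i).adj.reachable
    | succ k ih => exact fun i => (ih 0).trans (Link.mid n k 0 i).adj.reachable
  have hleft : ∀ n k i, graph.Reachable (trunk 0 0) (left n k i) := by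
    intro n k
    induction k with
    | zero => exact fun i => (hsep0 n).trans (Link.sep_left n 0 i (Or.inl rfl)).adj.reachable
    | succ k ih => exact fun i => (ih 0).trans (Link.left n k 0 i).adj.reachable
  rw [connected_iff_exists_forall_reachable]
  refine ⟨trunk 0 0, ?_⟩
  rintro (⟨k, i⟩ | ⟨n, w⟩ | ⟨n, k, i⟩ | ⟨n, k, i⟩)
  · exact htrunk k i
  · exact (hmid n 0 0).trans (Link.sep_mid n w 0).adj.reachable.symm
  · exact hmid n k i
  · exact hleft n k i

instance : Countable Vertex := by
  have h : (⋃ d, {x : Vertex | x.rank ≤ d}) = Set.univ :=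
    Set.eq_univ_of_forall fun x => Set.mem_iUnion.2 ⟨x.rank, le_refl x.rank⟩
  exact Set.countable_univ_iff.1 (h ▸ Set.countable_iUnion fun d => (finite_rank_le d).countable)

instance : Infinite Vertex :=
  Infinite.of_injective (fun k => trunk k 0) fun _ _ h => by cases h; rfl

section Iso

variable {V : Type u} {N : Type v} {G : SimpleGraph V} {T : SimpleGraph N}

theorem isThickRay_trunk (φ : graph ≃g G) : IsThickRay G fun k i => φ (trunk k i) where
  inj _ _ _ _ h := by cases φ.injective h; exact ⟨rfl, rfl⟩
  adj k i j := φ.map_adj_iff.2 (Link.trunk k i j).adj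

theorem isThickRay_mid (φ : graph ≃g G) (n : ℕ) : IsThickRay G fun k i => φ (mid n k i) where
  inj _ _ _ _ h := by cases φ.injective h; exact ⟨rfl, rfl⟩
  adj k i j := φ.map_adj_iff.2 (Link.mid n k i j).adj

theorem isThickRay_left (φ : graph ≃g G) (n : ℕ) : IsThickRay G fun k i => φ (left n k i) where
  inj _ _ _ _ h := by cases φ.injective h; exact ⟨rfl, rfl⟩
  adj k i j := φ.map_adj_iff.2 (Link.left n k i j).adj

/-- The part of the graph behind `sep n 0`, `sep n 1`, `sep n 2`. -/
def midSide (n : ℕ) : Set Vertex := {x | x.index = n ∧ ∀ i, x ≠ trunk n i} \ sep n '' {0, 1, 2}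

/-- The part of the graph behind `sep n 0`, `sep n 3`. -/
def leftSide (n : ℕ) : Set Vertex := {x | ∃ k i, x = left n k i}

theorem midSide_closed {n : ℕ} {x y : Vertex} (hx : x ∈ midSide n) (h : graph.Adj x y) :
    y ∈ midSide n ∪ sep n '' {0, 1, 2} := by
  obtain ⟨⟨rfl, hx⟩, hxs⟩ := hx
  rw [midSide, Set.sdiff_union_self]
  rcases h with h | h <;> cases h <;> simp_all [Vertex.index]
  omega

theorem leftSide_closed {n : ℕ} {x y : Vertex} (hx : x ∈ leftSide n) (h : graph.Adj x y) :
    y ∈ leftSide n ∪ sep n '' {0, 3} := by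
  obtain ⟨k, i, rfl⟩ := hx
  rcases h with h | h <;> cases h <;> simp_all [leftSide]

theorem image_closed (φ : graph ≃g G) {C X : Set Vertex}
    (hC : ∀ {x y}, x ∈ C → graph.Adj x y → y ∈ C ∪ X) :
    ∀ u ∈ φ '' C, ∀ v, G.Adj u v → v ∈ φ '' C ∪ φ '' X := by
  rintro _ ⟨x, hx, rfl⟩ v h
  obtain ⟨y, rfl⟩ := φ.surjective v
  rw [← Set.image_union]
  exact ⟨y, hC hx (φ.map_adj_iff.1 h), rfl⟩

theorem ncard_image_sep (φ : graph ≃g G) (n : ℕ) (A : Finset (Fin 4)) :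
    (φ '' (sep n '' (A : Set (Fin 4)))).ncard = A.card := by
  rw [Set.ncard_image_of_injective _ φ.injective, Set.ncard_image_of_injective,
    Set.ncard_coe_finset]
  intro _ _ h
  cases h
  rfl

theorem not_linked_tight_componental_disjoint (φ : graph ≃g G) (D : RootedTreeDecomp G T)
    (hfin : D.toTreeDecomp.FiniteParts) (hL : D.Linked) (hT : D.Tight) (hK : D.Componental) :
    ¬ ∀ s t s' t' : N, D.IsOrientedEdge s t → D.IsOrientedEdge s' t' →
      D.le t t' → t ≠ t' → (D.bag s ∩ D.bag t) ∩ (D.bag s' ∩ D.bag t') = ∅ := by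
  intro hdisj
  have hP := isThickRay_trunk φ
  obtain ⟨_, s, -, ⟨K, hK'⟩, hs0⟩ := hP.exists_captured_disjoint hfin hdisj
    (Set.finite_range fun i => φ (trunk 0 i))
  obtain ⟨d, hd⟩ := ((hfin s).image fun x => (φ.symm x).index).bddAbove
  set n := max K (d + 1)
  have hbag : ∀ x : Vertex, x.index = n → φ x ∉ D.bag s := by
    intro x hx h
    have : (φ.symm (φ x)).index ≤ d := hd ⟨φ x, h, rfl⟩
    rw [φ.symm_apply_apply, hx] at this
    omega
  have habove : ∀ {x y : Vertex}, φ x ∈ D.above s → x.index = n → graph.Adj x y →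
      φ y ∈ D.above s := fun hx hxn h =>
    RootedTreeDecomp.above_adj hx (hbag _ hxn) (φ.map_adj_iff.2 h)
  have htrunk : φ (trunk n 0) ∈ D.above s := hK' n (le_max_left _ _) 0
  have hsep : φ (sep n 0) ∈ D.above s :=
    habove htrunk rfl (Link.trunk_sep n 0 0 (by decide)).adj
  have hmid : ∀ k i, φ (mid n k i) ∈ D.above s := by
    intro k
    induction k with
    | zero => exact fun i => habove hsep rfl (Link.sep_mid n 0 i).adj
    | succ k ih => exact fun i => habove (ih 0) rfl (Link.mid n k 0 i).adj
  have hleft : ∀ k i, φ (left n k i) ∈ D.above s := by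
    intro k
    induction k with
    | zero => exact fun i => habove hsep rfl (Link.sep_left n 0 i (Or.inl rfl)).adj
    | succ k ih => exact fun i => habove (ih 0) rfl (Link.left n k 0 i).adj
  have hP0 : ∀ f, D.le s f → ∀ i, φ (trunk 0 i) ∉ D.above f := fun f hf i h =>
    Set.disjoint_left.1 hs0 (RootedTreeDecomp.above_subset_of_le hf h) ⟨i, rfl⟩
  have hside : ∀ C : Set Vertex, (∀ x ∈ C, x.index = n) → Disjoint (D.bag s) (φ '' C) := by
    intro C hC
    rw [Set.disjoint_right]
    rintro _ ⟨x, hx, rfl⟩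
    exact hbag x (hC x hx)
  have hcardB : (φ '' (sep n '' {0, 1, 2})).ncard = 3 := by
    have h := ncard_image_sep φ n {0, 1, 2}
    simp only [Finset.coe_insert, Finset.coe_singleton] at h
    exact h
  have hcardL : (φ '' (sep n '' {0, 3})).ncard = 2 := by
    have h := ncard_image_sep φ n {0, 3}
    simp only [Finset.coe_insert, Finset.coe_singleton] at h
    exact h
  obtain ⟨p, f, hpf, hsf, hfc, hf⟩ := (isThickRay_mid φ n).exists_adhesion_ncard_le hfin hL hT hK
    hdisj (((Set.toFinite {0, 1, 2}).image (sep n)).image φ) (image_closed φ midSide_closed)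
    (fun k i => ⟨_, by simp [midSide, Vertex.index], rfl⟩) (hside (midSide n) fun x hx => hx.1.1)
    hmid htrunk (by simp [midSide])
  obtain ⟨p', f', hpf', hsf', hfc', hf'⟩ := (isThickRay_left φ n).exists_adhesion_ncard_le hfin
    hL hT hK hdisj (((Set.toFinite {0, 3}).image (sep n)).image φ)
    (image_closed φ leftSide_closed) (fun k i => ⟨_, ⟨k, i, rfl⟩, rfl⟩)
    (hside (leftSide n) fun x ⟨_, _, hx⟩ => by rw [hx]; rfl) hleft htrunk (by simp [leftSide])
  rw [hcardB] at hf
  rw [hcardL] at hf'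
  have hB : ∀ w : Fin 4, w ≠ 3 → φ (sep n w) ∈ D.bag p ∩ D.bag f := fun w hw =>
    hP.mem_adhesion_of_adj (isThickRay_mid φ n) hfin hpf hf (hP0 f hsf) hfc
      (fun i => φ.map_adj_iff.2 (Link.trunk_sep n i w hw).adj)
      (fun i => φ.map_adj_iff.2 (Link.sep_mid n w i).adj.symm)
  have hL0 : φ (sep n 0) ∈ D.bag p' ∩ D.bag f' :=
    hP.mem_adhesion_of_adj (isThickRay_left φ n) hfin hpf' (hf'.trans (by norm_num))
      (hP0 f' hsf') hfc' (fun i => φ.map_adj_iff.2 (Link.trunk_sep n i 0 (by decide)).adj)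
      (fun i => φ.map_adj_iff.2 (Link.sep_left n 0 i (Or.inl rfl)).adj.symm)
  have hBeq : φ '' (sep n '' {0, 1, 2}) = D.bag p ∩ D.bag f := by
    refine Set.eq_of_subset_of_ncard_le ?_ (hf.trans hcardB.ge) ((hfin p).inter_of_left _)
    rintro _ ⟨_, ⟨w, hw, rfl⟩, rfl⟩
    exact hB w (by rintro rfl; simp at hw)
  have hne : f ≠ f' := by
    rintro rfl
    obtain rfl := hpf.eq_of_adj hpf'.1 hpf'.not_le
    rw [← hBeq, hcardB] at hf'
    exact absurd hf' (by decide)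
  have hleftf : ∀ k i, φ (left n k i) ∈ D.above f := by
    have hmem : ∀ x : Vertex, x ∉ sep n '' {0, 1, 2} → φ x ∉ D.bag p ∩ D.bag f := by
      intro x hx
      rwa [← hBeq, φ.injective.mem_set_image]
    obtain ⟨k, hk⟩ := hfc
    have hmid0 := (isThickRay_mid φ n).mem_strictAbove_of_column hpf (i := 0)
      (fun k => hmem _ (by simp)) (hk k le_rfl 0) 0
    have ha : φ (sep n 3) ∈ D.above f :=
      hpf.above_adj hmid0 (φ.map_adj_iff.2 (Link.sep_mid n 3 0).adj.symm)
    have hleft0 : ∀ i, φ (left n 0 i) ∈ D.above f := fun i =>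
      hpf.above_adj ⟨ha, hmem _ (by simp)⟩
        (φ.map_adj_iff.2 (Link.sep_left n 3 i (Or.inr rfl)).adj)
    exact fun k i => ((isThickRay_left φ n).mem_strictAbove_of_column hpf
      (fun k => hmem _ (by simp)) (hleft0 i) k).1
  obtain ⟨k, hk⟩ := (isThickRay_left φ n).exists_mem_strictAbove (s := p') hfin hfc'
  rcases hpf'.comparable (hk k le_rfl 0) (hleftf k 0) with h | h
  · exact (hdisj _ _ _ _ hpf' hpf h hne.symm ▸ ⟨hL0, hB 0 (by decide)⟩ :
      φ (sep n 0) ∈ (∅ : Set V))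
  · exact (hdisj _ _ _ _ hpf hpf' h hne ▸ ⟨hB 0 (by decide), hL0⟩ :
      φ (sep n 0) ∈ (∅ : Set V))

end Iso

end ThickRayTree

/-- There exists a locally finite connected graph that admits no rooted
tree-decomposition into finite parts which is linked, tight and componental and
additionally has upwards disjoint adhesion sets (`V_e ∩ V_{e'} = ∅` for all edges
`e < e'` of `T`). -/
theorem statement_14 :
    ∃ G : SimpleGraph ℕ, LocFin G ∧ G.Connected ∧
      ∀ (M : Type v) (T : SimpleGraph M) (D : RootedTreeDecomp G T),
        D.toTreeDecomp.FiniteParts →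
        ¬ (D.Linked ∧ D.Tight ∧ D.Componental ∧
            ∀ s t s' t' : M, D.IsOrientedEdge s t → D.IsOrientedEdge s' t' →
              D.le t t' → t ≠ t' →
              (D.bag s ∩ D.bag t) ∩ (D.bag s' ∩ D.bag t') = ∅) := by
  obtain ⟨_⟩ := nonempty_denumerable ThickRayTree.Vertex
  let φ := SimpleGraph.Iso.map (Denumerable.eqv ThickRayTree.Vertex) ThickRayTree.graph
  refine ⟨_, fun v => ?_, φ.connected_iff.1 ThickRayTree.connected_graph, ?_⟩
  · refine ((ThickRayTree.locFin_graph (φ.symm v)).image φ).subset fun w hw => ?_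
    exact ⟨φ.symm w, φ.symm.map_adj_iff.2 hw, φ.apply_symm_apply w⟩
  · rintro M T D hfin ⟨hL, hT, hK, hdisj⟩
    exact ThickRayTree.not_linked_tight_componental_disjoint φ D hfin hL hT hK hdisj
end

section
/- Let κ be an infinite cardinal. Every graph that admits a tree-decomposition of width < κ admits a rooted tree-decomposition of width < κ that is strongly linked; concretely, if (T, (V_t)) is a tree-decomposition of G of width < κ rooted at an arbitrary node r, then setting V'_t := ⋃_{s on the path rTt} V_s yields a strongly linked rooted tree-decomposition (T, (V'_t)) of G of width < κ. -/
open SimpleGraph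

universe u v

namespace TreeDecomp

variable {V : Type u} {N : Type v} {G : SimpleGraph V} {T : SimpleGraph N}

theorem path_isPath (D : TreeDecomp G T) (s t : N) : (D.path s t).IsPath :=
  (D.isTree.existsUnique_path s t).choose_spec.1

theorem eq_path (D : TreeDecomp G T) {s t : N} {p : T.Walk s t} (hp : p.IsPath) :
    p = D.path s t :=
  (D.isTree.existsUnique_path s t).choose_spec.2 p hp

theorem path_support_subset (D : TreeDecomp G T) {s t : N} (p : T.Walk s t) :
    (D.path s t).support ⊆ p.support := by
  classical
  rw [← D.eq_path p.bypass_isPath]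
  exact p.support_bypass_subset_support

theorem mem_path_comm (D : TreeDecomp G T) {s t x : N} (hx : x ∈ (D.path s t).support) :
    x ∈ (D.path t s).support := by
  simpa using D.path_support_subset (D.path t s).reverse hx

theorem mem_path_or_mem_path (D : TreeDecomp G T) {s t x : N}
    (hx : x ∈ (D.path s t).support) (m : N) :
    x ∈ (D.path s m).support ∨ x ∈ (D.path m t).support := by
  simpa [Walk.mem_support_append_iff] using
    D.path_support_subset ((D.path s m).append (D.path m t)) hx

theorem path_support_subset_of_mem (D : TreeDecomp G T) {s t a b : N}
    (ha : a ∈ (D.path s t).support) (hb : b ∈ (D.path s t).support) :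
    (D.path a b).support ⊆ (D.path s t).support := by
  classical
  intro x hx
  have h := D.path_support_subset
    (((D.path s t).takeUntil a ha).reverse.append ((D.path s t).takeUntil b hb)) hx
  rw [Walk.mem_support_append_iff, Walk.support_reverse, List.mem_reverse] at h
  exact h.elim (fun h => Walk.support_takeUntil_subset_support _ _ h)
    (fun h => Walk.support_takeUntil_subset_support _ _ h)

theorem length_path_lt (D : TreeDecomp G T) {s t a : N}
    (ha : a ∈ (D.path s t).support) (hat : a ≠ t) :
    (D.path s a).length < (D.path s t).length := by
  classical
  rw [← D.eq_path ((D.path_isPath s t).takeUntil ha)]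
  exact Walk.length_takeUntil_lt_length ha hat

theorem eq_of_mem_path_of_mem_path (D : TreeDecomp G T) {s a b : N}
    (ha : a ∈ (D.path s b).support) (hb : b ∈ (D.path s a).support) : a = b := by
  by_contra hab
  exact lt_asymm (D.length_path_lt ha hab) (D.length_path_lt hb (Ne.symm hab))

/-- The node of `sTt` closest to `r` lies on every path from `r` to a node of `sTt`. -/
theorem mem_path_of_length_minimal (D : TreeDecomp G T) {r s t m x : N}
    (hm : m ∈ (D.path s t).support)
    (hmin : ∀ y ∈ (D.path s t).support, (D.path r m).length ≤ (D.path r y).length)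
    (hx : x ∈ (D.path s t).support) : m ∈ (D.path r x).support := by
  have hp : ((D.path r m).append (D.path m x)).IsPath := by
    rw [Walk.isPath_def, Walk.support_append, List.nodup_append']
    refine ⟨(D.path_isPath r m).support_nodup,
      (D.path_isPath m x).support_nodup.sublist (List.tail_sublist _), ?_⟩
    intro y hy hy'
    have hym : y ≠ m := by
      rintro rfl
      have h := (D.path_isPath y x).support_nodup
      rw [← Walk.cons_tail_support] at h
      exact (List.nodup_cons.1 h).1 hy'
    exact (D.length_path_lt hy hym).not_ge
      (hmin y (D.path_support_subset_of_mem hm hx (List.mem_of_mem_tail hy')))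
  rw [← D.eq_path hp, Walk.mem_support_append_iff]
  exact Or.inl (Walk.end_mem_support _)

theorem exists_mem_bag_of_mem_path (D : TreeDecomp G T) {r s t x a b : N} {v : V}
    (ha : a ∈ (D.path r s).support) (hva : v ∈ D.bag a)
    (hb : b ∈ (D.path r t).support) (hvb : v ∈ D.bag b)
    (hx : x ∈ (D.path s t).support) : ∃ c ∈ (D.path r x).support, v ∈ D.bag c := by
  rcases D.mem_path_or_mem_path ha x with ha' | hax
  · exact ⟨a, ha', hva⟩
  rcases D.mem_path_or_mem_path hb x with hb' | hbx
  · exact ⟨b, hb', hvb⟩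
  refine ⟨x, Walk.end_mem_support _, ?_⟩
  rcases D.mem_path_or_mem_path hx a with hsa | hat
  · rwa [← D.eq_of_mem_path_of_mem_path (D.mem_path_comm hax) hsa]
  rcases D.mem_path_or_mem_path hat b with hab | hbt
  · exact D.bag_conn v _ (D.path_isPath a b) hva hvb x hab
  · rwa [D.eq_of_mem_path_of_mem_path (D.mem_path_comm hbt) (D.mem_path_comm hbx)]

/-- The rooted tree-decomposition obtained by replacing each bag `V_t` by the union of the bags
along the path from `r` to `t`. -/
def accumulate (D : TreeDecomp G T) (r : N) : RootedTreeDecomp G T where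
  isTree := D.isTree
  bag t := ⋃ x ∈ {x : N | x ∈ (D.path r t).support}, D.bag x
  bag_cover v := by
    obtain ⟨t, ht⟩ := D.bag_cover v
    exact ⟨t, Set.mem_biUnion (Walk.end_mem_support _) ht⟩
  bag_edge x y h := by
    obtain ⟨t, hx, hy⟩ := D.bag_edge h
    exact ⟨t, Set.mem_biUnion (Walk.end_mem_support _) hx,
      Set.mem_biUnion (Walk.end_mem_support _) hy⟩
  bag_conn v s t p hp hs ht x hx := by
    rw [D.eq_path hp] at hx
    simp only [Set.mem_iUnion, Set.mem_ofPred_eq, exists_prop] at hs ht ⊢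
    obtain ⟨a, ha, hva⟩ := hs
    obtain ⟨b, hb, hvb⟩ := ht
    exact D.exists_mem_bag_of_mem_path ha hva hb hvb hx
  root := r

theorem accumulate_bag_mono (D : TreeDecomp G T) {r m x : N} (h : m ∈ (D.path r x).support) :
    (D.accumulate r).bag m ⊆ (D.accumulate r).bag x :=
  Set.biUnion_subset_biUnion_left
    (D.path_support_subset_of_mem (Walk.start_mem_support _) h)

theorem accumulate_stronglyLinked (D : TreeDecomp G T) (r : N) :
    (D.accumulate r).toTreeDecomp.StronglyLinked := by
  intro s t hst
  obtain ⟨m, hm, hmin⟩ := Set.exists_min_image {y | y ∈ (D.path s t).support}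
    (fun y => (D.path r y).length) (List.finite_toSet _) ⟨s, Walk.start_mem_support _⟩
  have hsub : ∀ x ∈ (D.path s t).support,
      (D.accumulate r).bag m ⊆ (D.accumulate r).bag x := fun x hx =>
    D.accumulate_bag_mono (D.mem_path_of_length_minimal hm hmin hx)
  refine ⟨Cardinal.mk ↥((D.accumulate r).bag m), ?_, ?_, (D.accumulate r).bag m, rfl, ?_⟩
  · rintro a b ⟨-, hab⟩
    exact Cardinal.mk_le_mk_of_subset (Set.subset_inter
      (hsub a (Walk.fst_mem_support_of_mem_edges _ hab))
      (hsub b (Walk.snd_mem_support_of_mem_edges _ hab)))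
  · obtain ⟨e, he, hme⟩ :=
      (Walk.mem_support_iff_exists_mem_edges_of_not_nil (Walk.not_nil_of_ne hst)).1 hm
    obtain ⟨b, rfl⟩ := hme
    refine ⟨m, b, ⟨Walk.adj_of_mem_edges _ he, he⟩, ?_⟩
    rw [adh, Set.inter_eq_left.2 (hsub b (Walk.snd_mem_support_of_mem_edges _ he))]
  · refine ⟨Subtype.val, Subtype.val, fun _ => Walk.nil, fun _ => Walk.IsPath.nil,
      fun i => hsub s (Walk.start_mem_support _) i.2,
      fun i => hsub t (Walk.end_mem_support _) i.2, ?_⟩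
    intro i j hij x hx hx'
    rw [Walk.support_nil, List.mem_singleton] at hx hx'
    exact hij (Subtype.ext (hx.symm.trans hx'))

end TreeDecomp

theorem Cardinal.mk_biUnion_list_lt {V : Type u} {N : Type v} {κ : Cardinal.{u}}
    (hκ : Cardinal.aleph0 ≤ κ) {f : N → Set V} (hf : ∀ x, Cardinal.mk ↥(f x) < κ)
    (l : List N) : Cardinal.mk ↥(⋃ x ∈ {x : N | x ∈ l}, f x) < κ := by
  induction l with
  | nil => simpa using Cardinal.aleph0_pos.trans_le hκ
  | cons a l ih =>
    have h : (⋃ x ∈ {x : N | x ∈ a :: l}, f x) = f a ∪ ⋃ x ∈ {x : N | x ∈ l}, f x := by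
      ext v
      simp
    rw [h]
    exact (Cardinal.mk_union_le _ _).trans_lt (Cardinal.add_lt_of_lt hκ (hf a) ih)

/-- Let `κ` be an infinite cardinal. Every graph admitting a
tree-decomposition of width `< κ` admits a strongly linked rooted tree-decomposition of
width `< κ`: rooting `(T, (V_t))` at an arbitrary node `r` and setting
`V'_t := ⋃_{s ∈ rTt} V_s` yields a strongly linked rooted tree-decomposition `(T, (V'_t))`
of `G` of width `< κ`. -/
theorem statement_16 {V : Type u} {M : Type v} (κ : Cardinal.{u})
    (hκ : Cardinal.aleph0 ≤ κ)
    (G : SimpleGraph V) (T : SimpleGraph M) (D : TreeDecomp G T)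
    (hw : ∀ t : M, Cardinal.mk ↥(D.bag t) < κ) (r : M) :
    ∃ D' : RootedTreeDecomp G T, D'.root = r ∧
      (∀ t : M, D'.bag t = ⋃ x ∈ {x : M | x ∈ (D.path r t).support}, D.bag x) ∧
      (∀ t : M, Cardinal.mk ↥(D'.bag t) < κ) ∧
      D'.toTreeDecomp.StronglyLinked := by
  exact ⟨D.accumulate r, rfl, fun _ => rfl,
    fun t => Cardinal.mk_biUnion_list_lt hκ hw (D.path r t).support,
    D.accumulate_stronglyLinked r⟩
end

section
/- For every natural number m ≥ 1, the strong product of the one-way infinite path on ℕ with a finite path on m vertices has exactly one end, and this end has degree m (i.e. m is the maximum number of pairwise disjoint rays belonging to this end). -/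
open SimpleGraph

universe u v

theorem ConnAvoiding.of_adj {V : Type u} {G : SimpleGraph V} {X : Set V} {x y : V}
    (h : G.Adj x y) (hx : x ∉ X) (hy : y ∉ X) : ConnAvoiding G X x y :=
  ⟨h.toWalk, by simp [hx, hy]⟩

theorem ConnAvoiding.refl {V : Type u} {G : SimpleGraph V} {X : Set V} {x : V} (hx : x ∉ X) :
    ConnAvoiding G X x x :=
  ⟨.nil, by simpa using hx⟩

theorem ConnAvoiding.symm {V : Type u} {G : SimpleGraph V} {X : Set V} {x y : V}
    (h : ConnAvoiding G X x y) : ConnAvoiding G X y x := by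
  obtain ⟨p, hp⟩ := h
  exact ⟨p.reverse, by simpa using hp⟩

theorem ConnAvoiding.trans {V : Type u} {G : SimpleGraph V} {X : Set V} {x y z : V}
    (h : ConnAvoiding G X x y) (h' : ConnAvoiding G X y z) : ConnAvoiding G X x z := by
  obtain ⟨p, hp⟩ := h
  obtain ⟨q, hq⟩ := h'
  refine ⟨p.append q, fun w hw => ?_⟩
  rcases (Walk.mem_support_append_iff p q).1 hw with hw | hw
  exacts [hp w hw, hq w hw]

/-- Vertices of the strip `ℕ ⊠ P_m` are adjacent iff they are distinct and both coordinates
differ by at most one. -/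
theorem strongProd_natRay_finPath_adj {m : ℕ} {x y : ℕ × Fin m} :
    (strongProd natRayGraph (finPathGraph m)).Adj x y ↔
      x ≠ y ∧ (x.1 ≤ y.1 + 1 ∧ y.1 ≤ x.1 + 1) ∧
        ((x.2 : ℕ) ≤ y.2 + 1 ∧ (y.2 : ℕ) ≤ x.2 + 1) := by
  simp only [strongProd, natRayGraph, finPathGraph, SimpleGraph.fromRel_adj, ne_eq, Fin.ext_iff]
  exact and_congr_right fun _ => by omega

theorem isRay_row {m : ℕ} (i : Fin m) :
    IsRay (strongProd natRayGraph (finPathGraph m)) (fun n => (n, i)) :=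
  ⟨fun a b h => congrArg Prod.fst h, fun n => strongProd_natRay_finPath_adj.2 (by simp; omega)⟩

theorem connAvoiding_strip {m N : ℕ} {X : Set (ℕ × Fin m)} (hX : ∀ x ∈ X, x.1 ≤ N)
    {x y : ℕ × Fin m} (hx : N < x.1) (hy : N < y.1) :
    ConnAvoiding (strongProd natRayGraph (finPathGraph m)) X x y := by
  have avoid : ∀ (a : ℕ) (i : Fin m), N < a → (a, i) ∉ X := fun a i ha h =>
    absurd (hX _ h) (by simpa using ha)
  have row : ∀ (i : Fin m) (a b : ℕ), N < a → a ≤ b →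
      ConnAvoiding (strongProd natRayGraph (finPathGraph m)) X (a, i) (b, i) := by
    intro i a b ha hab
    induction b, hab using Nat.le_induction with
    | base => exact .refl (avoid a i ha)
    | succ b hab ih =>
      exact ih.trans (.of_adj ((isRay_row i).2 b) (avoid _ _ (by omega)) (avoid _ _ (by omega)))
  have column : ∀ (a : ℕ) (i : Fin m) (d : ℕ) (h : (i : ℕ) + d < m), N < a →
      ConnAvoiding (strongProd natRayGraph (finPathGraph m)) X (a, i) (a, ⟨i + d, h⟩) := by
    intro a i d h ha
    induction d with
    | zero => exact .refl (avoid a i ha)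
    | succ d ih =>
      refine (ih (by omega)).trans (.of_adj ?_ (avoid _ _ ha) (avoid _ _ ha))
      rw [strongProd_natRay_finPath_adj]
      simp only [ne_eq, Prod.mk.injEq, Fin.mk.injEq]
      omega
  have hm : 0 < m := x.2.pos
  have bottom : ∀ z : ℕ × Fin m, N < z.1 →
      ConnAvoiding (strongProd natRayGraph (finPathGraph m)) X (N + 1, ⟨0, hm⟩) z := by
    intro z hz
    have h := column z.1 ⟨0, hm⟩ z.2 (by simp) hz
    simp only [zero_add, Fin.eta] at h
    exact (row _ _ _ (by omega) hz).trans h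
  exact (bottom x hx).symm.trans (bottom y hy)

theorem Function.Injective.exists_forall_ge_lt_fst {m : ℕ} {r : ℕ → ℕ × Fin m}
    (hr : Function.Injective r) (N : ℕ) : ∃ M, ∀ n ≥ M, N < (r n).1 := by
  have hfin : {x : ℕ × Fin m | x.1 ≤ N}.Finite :=
    ((Set.finite_Iic N).prod Set.finite_univ).subset fun x hx => ⟨hx, trivial⟩
  obtain ⟨M, hM⟩ := (hfin.preimage hr.injOn).bddAbove
  refine ⟨M + 1, fun n hn => ?_⟩
  by_contra! h
  have : n ≤ M := hM h
  omega

theorem IsRay.exists_fst_eq {m : ℕ} {r : ℕ → ℕ × Fin m}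
    (hr : IsRay (strongProd natRayGraph (finPathGraph m)) r) {N : ℕ} (hN : (r 0).1 ≤ N) :
    ∃ k, (r k).1 = N := by
  obtain ⟨M, hM⟩ := hr.1.exists_forall_ge_lt_fst N
  have hex : ∃ k, N ≤ (r k).1 := ⟨M, (hM M le_rfl).le⟩
  refine ⟨Nat.find hex, le_antisymm ?_ (Nat.find_spec hex)⟩
  rcases hk : Nat.find hex with _ | k
  · exact hN
  · have hlt := Nat.find_min hex (m := k) (by omega)
    have := (strongProd_natRay_finPath_adj.1 (hr.2 k)).2.1
    omega

theorem not_disjoint_rays_succ (m : ℕ) :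
    ¬ ∃ f : Fin (m + 1) → ℕ → ℕ × Fin m,
      (∀ i, IsRay (strongProd natRayGraph (finPathGraph m)) (f i)) ∧
      Pairwise fun i j => ∀ k l : ℕ, f i k ≠ f j l := by
  rintro ⟨f, hf, hdisj⟩
  obtain ⟨N, hN⟩ := (Set.finite_range fun i => (f i 0).1).bddAbove
  choose k hk using fun i => (hf i).exists_fst_eq (hN ⟨i, rfl⟩)
  obtain ⟨i, j, hij, h⟩ :=
    Fintype.exists_ne_map_eq_of_card_lt (fun i => (f i (k i)).2) (by simp)
  exact hdisj hij (k i) (k j) (Prod.ext ((hk i).trans (hk j).symm) h)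

/-- For every `m ≥ 1`, the strong product of the one-way infinite path on `ℕ`
with a finite path on `m` vertices has exactly one end (it has a ray, and all rays are
equivalent), and this end has degree `m`: there are `m` pairwise disjoint rays but no
`m + 1` pairwise disjoint rays. -/
theorem statement_18 (m : ℕ) (hm : 1 ≤ m) :
    (∃ r : ℕ → ℕ × Fin m, IsRay (strongProd natRayGraph (finPathGraph m)) r) ∧
    (∀ r r' : ℕ → ℕ × Fin m, IsRay (strongProd natRayGraph (finPathGraph m)) r →
      IsRay (strongProd natRayGraph (finPathGraph m)) r' →
      RayEquiv (strongProd natRayGraph (finPathGraph m)) r r') ∧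
    (∃ f : Fin m → ℕ → ℕ × Fin m,
      (∀ i, IsRay (strongProd natRayGraph (finPathGraph m)) (f i)) ∧
      Pairwise fun i j => ∀ k l : ℕ, f i k ≠ f j l) ∧
    ¬ ∃ f : Fin (m + 1) → ℕ → ℕ × Fin m,
      (∀ i, IsRay (strongProd natRayGraph (finPathGraph m)) (f i)) ∧
      Pairwise fun i j => ∀ k l : ℕ, f i k ≠ f j l := by
  refine ⟨⟨_, isRay_row ⟨0, hm⟩⟩, fun r r' hr hr' X hX => ?_,
    ⟨fun i n => (n, i), isRay_row, fun i j hij k l h => hij (congrArg Prod.snd h)⟩,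
    not_disjoint_rays_succ m⟩
  obtain ⟨N, hN⟩ := (hX.image Prod.fst).bddAbove
  obtain ⟨M, hM⟩ := hr.1.exists_forall_ge_lt_fst N
  obtain ⟨M', hM'⟩ := hr'.1.exists_forall_ge_lt_fst N
  exact ⟨max M M', fun a ha b hb => connAvoiding_strip (fun x hx => hN ⟨x, hx, rfl⟩)
    (hM a (le_of_max_le_left ha)) (hM' b (le_of_max_le_right hb))⟩
end
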